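/- Let m be a positive integer and let J, K ⊆ {0,1,…,m−1} with |J| = |K| = 3. Then H_{J,K,m} is a Hadamard submatrix of the Fourier matrix F_m if and only if ν₃^min(P_m(J)\{1}) + ν₃^min(P_m(K)\{1}) = ν₃^max(P_m(J)\{1}) + ν₃^max(P_m(K)\{1}) = ν₃(m) + 1, and ν_p^max(P_m(J)\{1}) + ν_p^max(P_m(K)\{1}) ≤ ν_p(m) for all primes p other than 3. -/

import Mathlib

open Finset

/-- The difference set `D(X) = {x₁ - x₂ : x₁, x₂ ∈ X}` of a finite set of naturals. -/
def diffSet (X : Finset ℕ) : Finset ℤ :=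
  (X ×ˢ X).image fun q => (q.1 : ℤ) - (q.2 : ℤ)

/-- The `m`-th primitive set `P_m(X) = {m / gcd(m,d) : d ∈ D(X)}`. -/
def primSet (m : ℕ) (X : Finset ℕ) : Finset ℕ :=
  (diffSet X).image fun d => m / Nat.gcd m d.natAbs

/-- `H_{J,K,m}` is a Hadamard submatrix of the Fourier matrix `F_m`:
for all distinct `j₁ j₂ ∈ J`, `∑_{k ∈ K} e^{2πi(j₁-j₂)k/m} = 0`. -/
def IsHadamardSub (m : ℕ) (J K : Finset ℕ) : Prop :=
  ∀ j₁ ∈ J, ∀ j₂ ∈ J, j₁ ≠ j₂ →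
    ∑ k ∈ K, Complex.exp (2 * Real.pi * Complex.I * ((j₁ : ℂ) - (j₂ : ℂ)) * (k : ℂ) / (m : ℂ)) = 0

/-- `ν_p^max` of a finite set of naturals. -/
noncomputable def nuMaxN (p : ℕ) (S : Finset ℕ) : ℕ := S.sup fun n => padicValNat p n

/-- `ν_p^min` of a finite set of naturals (0 for the empty set). -/
noncomputable def nuMinN (p : ℕ) (S : Finset ℕ) : ℕ :=
  if h : S.Nonempty then S.inf' h fun n => padicValNat p n else 0

/-- `ν_p^max` of a finite set of integers. -/
noncomputable def nuMaxI (p : ℕ) (S : Finset ℤ) : ℕ := S.sup fun d => padicValInt p d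

/-- `ν_p^min` of a finite set of integers (0 for the empty set). -/
noncomputable def nuMinI (p : ℕ) (S : Finset ℤ) : ℕ :=
  if h : S.Nonempty then S.inf' h fun d => padicValInt p d else 0

/-- `C_m(X) = ∏_{s ∈ P_m(X) \ {1}} Φ_s(1)`. -/
noncomputable def Cm (m : ℕ) (X : Finset ℕ) : ℤ :=
  ∏ s ∈ (primSet m X).erase 1, (Polynomial.cyclotomic s ℤ).eval 1

theorem aux_three (x y z : ℂ) (hx : ‖x‖ = 1) (hy : ‖y‖ = 1) (hz : ‖z‖ = 1)
    (h : x + y + z = 0) : x ^ 3 = y ^ 3 ∧ x ≠ y := by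
  have e : ∀ w : ℂ, ‖w‖ = 1 → w * (starRingEnd ℂ) w = 1 := by
    intro w hw
    rw [Complex.mul_conj, Complex.normSq_eq_norm_sq, hw]; simp
  have ex := e x hx
  have ey := e y hy
  have ez := e z hz
  have hc : (starRingEnd ℂ) x + (starRingEnd ℂ) y + (starRingEnd ℂ) z = 0 := by
    rw [← map_add, ← map_add, h, map_zero]
  have h2 : y * z + x * z + x * y = 0 := by
    linear_combination (x * y * z) * hc - y * z * ex - x * z * ey - x * y * ez
  have h3 : x ^ 2 + x * y + y ^ 2 = 0 := by
    linear_combination (x + y) * h - h2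
  refine ⟨by linear_combination (x - y) * h3, ?_⟩
  rintro rfl
  have : x ^ 2 = 0 := by linear_combination h3 / 3
  have : x = 0 := by simpa using this
  rw [this] at hx
  simp at hx

theorem aux_three_conv (x y z : ℂ) (hxy : x ^ 3 = y ^ 3) (hxy' : x ≠ y)
    (hxz : x ^ 3 = z ^ 3) (hxz' : x ≠ z) (hyz' : y ≠ z) : x + y + z = 0 := by
  have h1 : x ^ 2 + x * y + y ^ 2 = 0 := by
    apply mul_left_cancel₀ (sub_ne_zero.2 hxy')
    linear_combination hxy
  have h2 : x ^ 2 + x * z + z ^ 2 = 0 := by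
    apply mul_left_cancel₀ (sub_ne_zero.2 hxz')
    linear_combination hxz
  apply mul_left_cancel₀ (sub_ne_zero.2 hyz')
  linear_combination h1 - h2

theorem aux_exp (m : ℕ) (hm : 0 < m) (a : ℤ) (k : ℕ) :
    Complex.exp (2 * Real.pi * Complex.I * (a : ℂ) * (k : ℂ) / (m : ℂ))
      = Complex.exp (2 * Real.pi * Complex.I / (m : ℂ)) ^ (a * k : ℤ) := by
  rw [← Complex.exp_int_mul]
  congr 1
  push_cast
  ring

theorem aux_zpow (m : ℕ) (hm : 0 < m) (s t : ℤ) :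
    Complex.exp (2 * Real.pi * Complex.I / (m : ℂ)) ^ s
      = Complex.exp (2 * Real.pi * Complex.I / (m : ℂ)) ^ t ↔ (m : ℤ) ∣ s - t := by
  rw [← (Complex.isPrimitiveRoot_exp m hm.ne').zpow_eq_one_iff_dvd, zpow_sub₀ (Complex.exp_ne_zero _),
    div_eq_one_iff_eq (zpow_ne_zero _ (Complex.exp_ne_zero _))]

theorem aux_sum (m : ℕ) (hm : 0 < m) (K : Finset ℕ) (hK3 : K.card = 3) (a : ℤ) :
    ∑ k ∈ K, Complex.exp (2 * Real.pi * Complex.I * (a : ℂ) * (k : ℂ) / (m : ℂ)) = 0 ↔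
    ∀ k₁ ∈ K, ∀ k₂ ∈ K, k₁ ≠ k₂ →
      ((m : ℤ) ∣ 3 * (a * ((k₁ : ℤ) - k₂)) ∧ ¬ (m : ℤ) ∣ a * ((k₁ : ℤ) - k₂)) := by
  set f : ℕ → ℂ := fun k =>
    Complex.exp (2 * Real.pi * Complex.I * (a : ℂ) * (k : ℂ) / (m : ℂ)) with hf
  have hn : ∀ k, ‖f k‖ = 1 := by
    intro k
    have : f k = Complex.exp (((2 * Real.pi * a * k / m : ℝ) : ℂ) * Complex.I) := by
      simp only [hf]
      congr 1
      push_cast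
      ring
    rw [this, Complex.norm_exp_ofReal_mul_I]
  have h1 : ∀ k₁ k₂, f k₁ = f k₂ ↔ (m : ℤ) ∣ a * ((k₁ : ℤ) - k₂) := by
    intro k₁ k₂
    simp only [hf]
    rw [aux_exp m hm, aux_exp m hm, aux_zpow m hm, mul_sub]
  have h3 : ∀ k₁ k₂, f k₁ ^ 3 = f k₂ ^ 3 ↔ (m : ℤ) ∣ 3 * (a * ((k₁ : ℤ) - k₂)) := by
    intro k₁ k₂
    simp only [hf]
    rw [aux_exp m hm, aux_exp m hm, ← zpow_natCast, ← zpow_natCast, ← zpow_mul, ← zpow_mul,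
      aux_zpow m hm]
    have : a * (k₁ : ℤ) * ((3 : ℕ) : ℤ) - a * (k₂ : ℤ) * ((3 : ℕ) : ℤ)
      = 3 * (a * ((k₁ : ℤ) - k₂)) := by push_cast; ring
    rw [this]
  simp only [← h1, ← h3]
  obtain ⟨x, y, z, hxy, hxz, hyz, rfl⟩ := Finset.card_eq_three.1 hK3
  have hs : ∑ k ∈ ({x, y, z} : Finset ℕ),
      Complex.exp (2 * Real.pi * Complex.I * (a : ℂ) * (k : ℂ) / (m : ℂ)) = f x + f y + f z := by
    rw [Finset.sum_insert (by simp [hxy, hxz]), Finset.sum_insert (by simp [hyz]),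
      Finset.sum_singleton, ← add_assoc]
  rw [hs]
  constructor
  · intro h
    have a1 := aux_three _ _ _ (hn x) (hn y) (hn z) h
    have a2 := aux_three _ _ _ (hn x) (hn z) (hn y) (by linear_combination h)
    have a3 := aux_three _ _ _ (hn y) (hn z) (hn x) (by linear_combination h)
    intro k₁ hk₁ k₂ hk₂ hne
    simp only [Finset.mem_insert, Finset.mem_singleton] at hk₁ hk₂
    rcases hk₁ with rfl | rfl | rfl <;> rcases hk₂ with rfl | rfl | rfl
    · exact absurd rfl hne
    · exact a1
    · exact a2
    · exact ⟨a1.1.symm, fun q => a1.2 q.symm⟩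
    · exact absurd rfl hne
    · exact a3
    · exact ⟨a2.1.symm, fun q => a2.2 q.symm⟩
    · exact ⟨a3.1.symm, fun q => a3.2 q.symm⟩
    · exact absurd rfl hne
  · intro h
    have a1 := h x (by simp) y (by simp) hxy
    have a2 := h x (by simp) z (by simp) hxz
    have a3 := h y (by simp) z (by simp) hyz
    exact aux_three_conv _ _ _ a1.1 a1.2 a2.1 a2.2 a3.2

theorem aux_val (m a p : ℕ) (hm : 0 < m) (ha : a ≠ 0) (hp : p.Prime) :
    padicValNat p (m / Nat.gcd m a) = padicValNat p m - padicValNat p a := by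
  rw [← Nat.factorization_def _ hp, ← Nat.factorization_def _ hp, ← Nat.factorization_def _ hp,
    Nat.factorization_div (Nat.gcd_dvd_left m a), Nat.factorization_gcd hm.ne' ha]
  simp only [Finsupp.coe_tsub, Pi.sub_apply, Finsupp.inf_apply]
  rcases le_total (m.factorization p) (a.factorization p) with h | h
  · rw [inf_eq_left.2 h]; omega
  · rw [inf_eq_right.2 h]

theorem aux_dvd (m n : ℕ) (hm : 0 < m) (hn : n ≠ 0) :
    m ∣ n ↔ ∀ p : ℕ, p.Prime → padicValNat p m ≤ padicValNat p n := by
  rw [← Nat.factorization_prime_le_iff_dvd hm.ne' hn]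
  refine forall₂_congr fun p hp => ?_
  rw [Nat.factorization_def _ hp, Nat.factorization_def _ hp]

theorem aux_arith (m a b : ℕ) (hm : 0 < m) (ha : a ≠ 0) (hb : b ≠ 0) :
    (m ∣ 3 * (a * b) ∧ ¬ m ∣ a * b) ↔
    (padicValNat 3 (m / Nat.gcd m a) + padicValNat 3 (m / Nat.gcd m b) = padicValNat 3 m + 1 ∧
      ∀ p : ℕ, p.Prime → p ≠ 3 →
        padicValNat p (m / Nat.gcd m a) + padicValNat p (m / Nat.gcd m b) ≤ padicValNat p m) := by
  have hab : a * b ≠ 0 := mul_ne_zero ha hb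
  have e1 : ∀ p : ℕ, p.Prime → padicValNat p (a * b) = padicValNat p a + padicValNat p b := by
    intro p hp
    haveI := Fact.mk hp
    exact padicValNat.mul ha hb
  have e2 : ∀ p : ℕ, p.Prime → p ≠ 3 →
      padicValNat p (3 * (a * b)) = padicValNat p a + padicValNat p b := by
    intro p hp h3
    haveI := Fact.mk hp
    rw [padicValNat.mul (by norm_num) hab, e1 p hp, padicValNat.eq_zero_of_not_dvd, zero_add]
    intro h
    exact h3 ((Nat.prime_dvd_prime_iff_eq hp Nat.prime_three).1 h)
  have e3 : padicValNat 3 (3 * (a * b)) = padicValNat 3 a + padicValNat 3 b + 1 := by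
    haveI := Fact.mk Nat.prime_three
    rw [padicValNat.mul (by norm_num) hab, e1 3 Nat.prime_three, padicValNat_self]
    omega
  rw [aux_dvd m _ hm (mul_ne_zero (by norm_num) hab), aux_dvd m _ hm hab,
    aux_val m a 3 hm ha Nat.prime_three, aux_val m b 3 hm hb Nat.prime_three]
  constructor
  · rintro ⟨h1, h2⟩
    have h4 := h1 3 Nat.prime_three
    rw [e3] at h4
    have h5 : padicValNat 3 a + padicValNat 3 b < padicValNat 3 m := by
      by_contra hcon
      apply h2
      intro p hp
      rw [e1 p hp]
      by_cases hp3 : p = 3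
      · subst hp3; omega
      · have := h1 p hp
        rwa [e2 p hp hp3] at this
    refine ⟨by omega, ?_⟩
    intro p hp hp3
    have := h1 p hp
    rw [e2 p hp hp3] at this
    rw [aux_val m a p hm ha hp, aux_val m b p hm hb hp]
    omega
  · rintro ⟨h1, h2⟩
    constructor
    · intro p hp
      by_cases hp3 : p = 3
      · subst hp3; omega
      · have := h2 p hp hp3
        rw [aux_val m a p hm ha hp, aux_val m b p hm hb hp] at this
        rw [e2 p hp hp3]
        omega
    · intro h
      have := h 3 Nat.prime_three
      rw [e1 3 Nat.prime_three] at this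
      omega

theorem aux_mem (m : ℕ) (hm : 0 < m) (X : Finset ℕ) (hX : X ⊆ Finset.range m) (s : ℕ) :
    s ∈ (primSet m X).erase 1 ↔ ∃ x ∈ X, ∃ y ∈ X, x ≠ y ∧
      m / Nat.gcd m ((x : ℤ) - y).natAbs = s := by
  simp only [primSet, diffSet, Finset.mem_erase, Finset.mem_image, Finset.mem_product, Prod.exists]
  constructor
  · rintro ⟨h1, d, ⟨x, y, ⟨hx, hy⟩, rfl⟩, rfl⟩
    refine ⟨x, hx, y, hy, ?_, rfl⟩
    rintro rfl
    apply h1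
    simp [Nat.div_self hm]
  · rintro ⟨x, hx, y, hy, hne, rfl⟩
    refine ⟨?_, _, ⟨x, y, ⟨hx, hy⟩, rfl⟩, rfl⟩
    intro h
    have hx' := Finset.mem_range.1 (hX hx)
    have hy' := Finset.mem_range.1 (hX hy)
    have hg : m = Nat.gcd m ((x : ℤ) - y).natAbs := by
      have := Nat.div_mul_cancel (Nat.gcd_dvd_left m ((x : ℤ) - y).natAbs)
      rw [h] at this
      omega
    have hd : m ∣ ((x : ℤ) - y).natAbs := by
      rw [hg]; exact Nat.gcd_dvd_right _ _
    have := Nat.le_of_dvd (by omega) hd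
    omega

theorem aux_max (p : ℕ) (S : Finset ℕ) (hS : S.Nonempty) :
    (∃ s ∈ S, nuMaxN p S = padicValNat p s) ∧ ∀ s ∈ S, padicValNat p s ≤ nuMaxN p S := by
  refine ⟨?_, fun s hs => Finset.le_sup (f := fun n => padicValNat p n) hs⟩
  obtain ⟨s, hs, h⟩ := Finset.exists_mem_eq_sup S hS (fun n => padicValNat p n)
  exact ⟨s, hs, h⟩

theorem aux_min (p : ℕ) (S : Finset ℕ) (hS : S.Nonempty) :
    (∃ s ∈ S, nuMinN p S = padicValNat p s) ∧ ∀ s ∈ S, nuMinN p S ≤ padicValNat p s := by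
  unfold nuMinN
  rw [dif_pos hS]
  refine ⟨?_, fun s hs => Finset.inf'_le (f := fun n => padicValNat p n) hs⟩
  obtain ⟨s, hs, h⟩ := Finset.exists_mem_eq_inf' hS (fun n => padicValNat p n)
  exact ⟨s, hs, h⟩

theorem aux_nonempty (m : ℕ) (hm : 0 < m) (X : Finset ℕ) (hX : X ⊆ Finset.range m)
    (hc : X.card = 3) : ((primSet m X).erase 1).Nonempty := by
  obtain ⟨x, y, z, hxy, hxz, hyz, rfl⟩ := Finset.card_eq_three.1 hc
  exact ⟨_, (aux_mem m hm _ hX _).2 ⟨x, by simp, y, by simp, hxy, rfl⟩⟩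

theorem hadamard_three_by_three_iff (m : ℕ) (hm : 0 < m) (J K : Finset ℕ)
    (hJ : J ⊆ Finset.range m) (hK : K ⊆ Finset.range m)
    (hJ3 : J.card = 3) (hK3 : K.card = 3) :
    IsHadamardSub m J K ↔
      (nuMinN 3 ((primSet m J).erase 1) + nuMinN 3 ((primSet m K).erase 1)
          = padicValNat 3 m + 1 ∧
       nuMaxN 3 ((primSet m J).erase 1) + nuMaxN 3 ((primSet m K).erase 1)
          = padicValNat 3 m + 1 ∧
       ∀ p : ℕ, p.Prime → p ≠ 3 →
         nuMaxN p ((primSet m J).erase 1) + nuMaxN p ((primSet m K).erase 1)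
           ≤ padicValNat p m) := by
  have key : IsHadamardSub m J K ↔
      ∀ s ∈ (primSet m J).erase 1, ∀ t ∈ (primSet m K).erase 1,
        padicValNat 3 s + padicValNat 3 t = padicValNat 3 m + 1 ∧
        ∀ p : ℕ, p.Prime → p ≠ 3 → padicValNat p s + padicValNat p t ≤ padicValNat p m := by
    have step : ∀ j₁ j₂ k₁ k₂ : ℕ, j₁ ≠ j₂ → k₁ ≠ k₂ →
        (((m : ℤ) ∣ 3 * (((j₁ : ℤ) - j₂) * ((k₁ : ℤ) - k₂)) ∧
          ¬ (m : ℤ) ∣ ((j₁ : ℤ) - j₂) * ((k₁ : ℤ) - k₂)) ↔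
        (m ∣ 3 * (((j₁ : ℤ) - j₂).natAbs * ((k₁ : ℤ) - k₂).natAbs) ∧
          ¬ m ∣ ((j₁ : ℤ) - j₂).natAbs * ((k₁ : ℤ) - k₂).natAbs)) := by
      intro j₁ j₂ k₁ k₂ hj hk
      rw [Int.natCast_dvd, Int.natCast_dvd, Int.natAbs_mul, Int.natAbs_mul]
      exact Iff.rfl
    have hs : ∀ j₁ j₂ : ℕ, _ := fun j₁ j₂ => aux_sum m hm K hK3 ((j₁ : ℤ) - j₂)
    push_cast at hs
    unfold IsHadamardSub
    constructor
    · intro h s hs' t ht'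
      obtain ⟨j₁, hj₁, j₂, hj₂, hj, rfl⟩ := (aux_mem m hm J hJ s).1 hs'
      obtain ⟨k₁, hk₁, k₂, hk₂, hk, rfl⟩ := (aux_mem m hm K hK t).1 ht'
      refine (aux_arith m ((j₁ : ℤ) - j₂).natAbs ((k₁ : ℤ) - k₂).natAbs hm (by omega) (by omega)).1 ?_
      exact (step j₁ j₂ k₁ k₂ hj hk).1 ((hs j₁ j₂).1 (h j₁ hj₁ j₂ hj₂ hj) k₁ hk₁ k₂ hk₂ hk)
    · intro h j₁ hj₁ j₂ hj₂ hj
      refine (hs j₁ j₂).2 fun k₁ hk₁ k₂ hk₂ hk => (step j₁ j₂ k₁ k₂ hj hk).2 ?_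
      refine (aux_arith m ((j₁ : ℤ) - j₂).natAbs ((k₁ : ℤ) - k₂).natAbs hm (by omega) (by omega)).2 ?_
      exact h _ ((aux_mem m hm J hJ _).2 ⟨j₁, hj₁, j₂, hj₂, hj, rfl⟩)
        _ ((aux_mem m hm K hK _).2 ⟨k₁, hk₁, k₂, hk₂, hk, rfl⟩)
  rw [key]
  have nJ := aux_nonempty m hm J hJ hJ3
  have nK := aux_nonempty m hm K hK hK3
  generalize (primSet m J).erase 1 = S at nJ ⊢
  generalize (primSet m K).erase 1 = T at nK ⊢
  constructor
  · intro h
    refine ⟨?_, ?_, fun p hp hp3 => ?_⟩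
    · obtain ⟨⟨s, hs, es⟩, -⟩ := aux_min 3 S nJ
      obtain ⟨⟨t, ht, et⟩, -⟩ := aux_min 3 T nK
      rw [es, et]; exact (h s hs t ht).1
    · obtain ⟨⟨s, hs, es⟩, -⟩ := aux_max 3 S nJ
      obtain ⟨⟨t, ht, et⟩, -⟩ := aux_max 3 T nK
      rw [es, et]; exact (h s hs t ht).1
    · obtain ⟨⟨s, hs, es⟩, -⟩ := aux_max p S nJ
      obtain ⟨⟨t, ht, et⟩, -⟩ := aux_max p T nK
      rw [es, et]; exact (h s hs t ht).2 p hp hp3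
  · rintro ⟨h1, h2, h3⟩ s hs t ht
    refine ⟨?_, fun p hp hp3 => ?_⟩
    · have b1 := (aux_min 3 S nJ).2 s hs
      have b2 := (aux_min 3 T nK).2 t ht
      have b3 := (aux_max 3 S nJ).2 s hs
      have b4 := (aux_max 3 T nK).2 t ht
      omega
    · have b3 := (aux_max p S nJ).2 s hs
      have b4 := (aux_max p T nK).2 t ht
      have := h3 p hp hp3
      omega
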